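/- Fix θ > 0 and let u_n(θ) be the smallest maximizer of k ↦ L_n(θ,k) on {1,…,n}. There exist constants C₀ > 0 and N such that for every n ≥ N satisfying | {u_n*(θ)} − 1/2 | > C₀/log n (where {x} = x − ⌊x⌋ is the fractional part and u_n*(θ) = θ log n − θψ(θ) − 1/2), the mode satisfies u_n(θ) = ⌊u_n*(θ) + 1/2⌋ = ⌊θ log n − θψ(θ)⌋. -/

import Mathlib

open Real Filter

/-- The Ewens probability mass function with parameter `θ`. -/
noncomputable def ewensPMF (n : ℕ) (θ : ℝ) (k : ℕ) : ℝ :=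
  θ ^ k * ((ascPochhammer ℕ n).coeff k : ℝ) / (ascPochhammer ℝ n).eval θ

/-- The digamma function `ψ(θ) = Γ′(θ)/Γ(θ)`, the derivative of `log ∘ Γ`. -/
noncomputable def digamma (θ : ℝ) : ℝ := deriv (fun x => Real.log (Real.Gamma x)) θ

/-- `u_n*(θ) = θ log n − θψ(θ) − 1/2`. -/
noncomputable def uStar (n : ℕ) (θ : ℝ) : ℝ := θ * Real.log n - θ * digamma θ - 1 / 2

/-- `u` is the smallest maximizer of `k ↦ L_n(θ,k)` on `{1,…,n}`. -/
def IsLeastMode (θ : ℝ) (n u : ℕ) : Prop :=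
  u ∈ Finset.Icc 1 n ∧ (∀ k ∈ Finset.Icc 1 n, ewensPMF n θ k ≤ ewensPMF n θ u) ∧
    ∀ v ∈ Finset.Icc 1 n, (∀ k ∈ Finset.Icc 1 n, ewensPMF n θ k ≤ ewensPMF n θ v) → u ≤ v

open Polynomial in
/-- The polynomial `∏ (1 + bᵢ X)`, whose coefficients are proportional to the law of a sum of
independent Bernoulli variables with odds `bᵢ`. -/
noncomputable def oddsPoly (b : ℕ → ℝ) (s : Finset ℕ) : ℝ[X] :=
  ∏ i ∈ s, (1 + C (b i) * X)

/-- The mean `∑ bᵢ / (1 + bᵢ)` of a sum of independent Bernoulli variables with odds `bᵢ`. -/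
noncomputable def oddsMean (b : ℕ → ℝ) (s : Finset ℕ) : ℝ := ∑ i ∈ s, b i / (1 + b i)

section OddsPoly

open Polynomial

variable {b : ℕ → ℝ} {s : Finset ℕ}

lemma oddsPoly_eq_erase {i : ℕ} (hi : i ∈ s) :
    oddsPoly b s = oddsPoly b (s.erase i) + C (b i) * (X * oddsPoly b (s.erase i)) := by
  unfold oddsPoly
  rw [← Finset.mul_prod_erase s _ hi]
  ring

lemma oddsPoly_coeff_eq_erase {i : ℕ} (hi : i ∈ s) (k : ℕ) :
    (oddsPoly b s).coeff k = (oddsPoly b (s.erase i)).coeff k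
      + b i * (X * oddsPoly b (s.erase i)).coeff k := by
  conv_lhs => rw [oddsPoly_eq_erase hi]
  rw [coeff_add, coeff_C_mul]

lemma oddsPoly_coeff_zero : (oddsPoly b s).coeff 0 = 1 := by
  simp [oddsPoly, coeff_zero_prod]

lemma oddsPoly_coeff_nonneg (hb : ∀ i ∈ s, 0 ≤ b i) (k : ℕ) : 0 ≤ (oddsPoly b s).coeff k := by
  induction s using Finset.induction_on generalizing k with
  | empty => simp only [oddsPoly, Finset.prod_empty, coeff_one]; split_ifs <;> norm_num
  | insert i s hi ih =>
    have hs : ∀ j, 0 ≤ (oddsPoly b s).coeff j :=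
      ih fun j hj => hb j (Finset.mem_insert_of_mem hj)
    rw [oddsPoly_coeff_eq_erase (Finset.mem_insert_self i s), Finset.erase_insert hi]
    have hbi := hb i (Finset.mem_insert_self i s)
    cases k with
    | zero => simpa using hs 0
    | succ k =>
      rw [coeff_X_mul]
      have := hs k
      have := hs (k + 1)
      positivity

lemma X_mul_oddsPoly_coeff_nonneg (hb : ∀ i ∈ s, 0 ≤ b i) (k : ℕ) :
    0 ≤ (X * oddsPoly b s).coeff k := by
  cases k with
  | zero => simp
  | succ k => rw [coeff_X_mul]; exact oddsPoly_coeff_nonneg hb k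

lemma oddsPoly_coeff_erase_le (hb : ∀ i ∈ s, 0 ≤ b i) {i : ℕ} (hi : i ∈ s) (k : ℕ) :
    (oddsPoly b (s.erase i)).coeff k ≤ (oddsPoly b s).coeff k := by
  rw [oddsPoly_coeff_eq_erase hi]
  have := mul_nonneg (hb i hi)
    (X_mul_oddsPoly_coeff_nonneg (s := s.erase i)
      (fun j hj => hb j (Finset.mem_of_mem_erase hj)) k)
  linarith

lemma X_mul_oddsPoly_coeff_erase_le (hb : ∀ i ∈ s, 0 ≤ b i) {i : ℕ} (hi : i ∈ s) (k : ℕ) :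
    (X * oddsPoly b (s.erase i)).coeff k ≤ (X * oddsPoly b s).coeff k := by
  cases k with
  | zero => simp
  | succ k => simpa only [coeff_X_mul] using oddsPoly_coeff_erase_le hb hi k

lemma succ_mul_oddsPoly_coeff_succ (k : ℕ) :
    ((k : ℝ) + 1) * (oddsPoly b s).coeff (k + 1)
      = ∑ i ∈ s, b i * (oddsPoly b (s.erase i)).coeff k := by
  have h : derivative (oddsPoly b s) = ∑ i ∈ s, C (b i) * oddsPoly b (s.erase i) := by
    unfold oddsPoly
    rw [derivative_prod_finset]
    refine Finset.sum_congr rfl fun i _ => ?_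
    rw [derivative_add, derivative_one, derivative_C_mul_X, zero_add, mul_comm]
  have h' := congrArg (fun p => coeff p k) h
  simp only [coeff_derivative, finsetSum_coeff, coeff_C_mul] at h'
  rw [← h', mul_comm]

/-- A Stein-type identity for the coefficients of `∏ (1 + bᵢ X)`. -/
lemma succ_mul_oddsPoly_coeff_succ_eq (hb : ∀ i ∈ s, 0 ≤ b i) (k : ℕ) :
    ((k : ℝ) + 1) * (oddsPoly b s).coeff (k + 1) - oddsMean b s * (oddsPoly b s).coeff k
      = ∑ i ∈ s, b i ^ 2 / (1 + b i) * ((oddsPoly b (s.erase i)).coeff k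
          - (X * oddsPoly b (s.erase i)).coeff k) := by
  rw [succ_mul_oddsPoly_coeff_succ, oddsMean, Finset.sum_mul, ← Finset.sum_sub_distrib]
  refine Finset.sum_congr rfl fun i hi => ?_
  rw [oddsPoly_coeff_eq_erase hi k]
  have : 1 + b i ≠ 0 := by have := hb i hi; positivity
  field_simp
  ring

lemma sq_div_one_add_nonneg (hb : ∀ i ∈ s, 0 ≤ b i) : ∀ i ∈ s, 0 ≤ b i ^ 2 / (1 + b i) := by
  intro i hi
  have := hb i hi
  positivity

lemma sum_sq_div_one_add_mul_le (hb : ∀ i ∈ s, 0 ≤ b i) {B : ℝ} (hB : ∑ i ∈ s, b i ^ 2 ≤ B)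
    {f : ℕ → ℝ} {c : ℝ} (hc : 0 ≤ c) (hf : ∀ i ∈ s, f i ≤ c) :
    ∑ i ∈ s, b i ^ 2 / (1 + b i) * f i ≤ B * c := by
  calc ∑ i ∈ s, b i ^ 2 / (1 + b i) * f i ≤ ∑ i ∈ s, b i ^ 2 * c := by
        refine Finset.sum_le_sum fun i hi => ?_
        have h0 := sq_div_one_add_nonneg hb i hi
        have h1 : b i ^ 2 / (1 + b i) ≤ b i ^ 2 :=
          div_le_self (sq_nonneg _) (by linarith [hb i hi])
        exact (mul_le_mul_of_nonneg_left (hf i hi) h0).trans (mul_le_mul_of_nonneg_right h1 hc)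
    _ = (∑ i ∈ s, b i ^ 2) * c := by rw [Finset.sum_mul]
    _ ≤ B * c := mul_le_mul_of_nonneg_right hB hc

lemma succ_mul_oddsPoly_coeff_succ_le (hb : ∀ i ∈ s, 0 ≤ b i) {B : ℝ}
    (hB : ∑ i ∈ s, b i ^ 2 ≤ B) (k : ℕ) :
    ((k : ℝ) + 1) * (oddsPoly b s).coeff (k + 1)
      ≤ (oddsMean b s + B) * (oddsPoly b s).coeff k := by
  have h := succ_mul_oddsPoly_coeff_succ_eq hb k
  have h2 := sum_sq_div_one_add_mul_le hb hB (oddsPoly_coeff_nonneg hb k)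
    (f := fun i => (oddsPoly b (s.erase i)).coeff k - (X * oddsPoly b (s.erase i)).coeff k)
    fun i hi => by
      have := oddsPoly_coeff_erase_le hb hi k
      have := X_mul_oddsPoly_coeff_nonneg (fun j hj => hb j (Finset.mem_of_mem_erase hj))
        k (s := s.erase i)
      linarith
  linarith

lemma le_succ_mul_oddsPoly_coeff_succ (hb : ∀ i ∈ s, 0 ≤ b i) {B : ℝ}
    (hB : ∑ i ∈ s, b i ^ 2 ≤ B) (k : ℕ) :
    oddsMean b s * (oddsPoly b s).coeff k - B * (X * oddsPoly b s).coeff k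
      ≤ ((k : ℝ) + 1) * (oddsPoly b s).coeff (k + 1) := by
  have h := succ_mul_oddsPoly_coeff_succ_eq hb k
  have h2 := sum_sq_div_one_add_mul_le hb hB (X_mul_oddsPoly_coeff_nonneg hb k)
    (f := fun i => -((oddsPoly b (s.erase i)).coeff k - (X * oddsPoly b (s.erase i)).coeff k))
    fun i hi => by
      have := X_mul_oddsPoly_coeff_erase_le hb hi k
      have := oddsPoly_coeff_nonneg (fun j hj => hb j (Finset.mem_of_mem_erase hj))
        k (s := s.erase i)
      linarith
  simp only [mul_neg, Finset.sum_neg_distrib] at h2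
  linarith

lemma X_mul_oddsPoly_coeff_le (hb : ∀ i ∈ s, 0 ≤ b i) {B : ℝ} (hB : ∑ i ∈ s, b i ^ 2 ≤ B)
    (hμ : 8 * B ≤ oddsMean b s) (hμ0 : 0 < oddsMean b s) (k : ℕ)
    (hk : (k : ℝ) ≤ 3 / 2 * oddsMean b s) :
    (X * oddsPoly b s).coeff k ≤ 2 * (oddsPoly b s).coeff k := by
  have hB0 : 0 ≤ B := (Finset.sum_nonneg fun i _ => sq_nonneg (b i)).trans hB
  induction k with
  | zero => simp [oddsPoly_coeff_zero]
  | succ k ih =>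
    push_cast at hk
    have ih := ih (by linarith)
    rw [coeff_X_mul]
    have h := le_succ_mul_oddsPoly_coeff_succ hb hB k
    have h0 := oddsPoly_coeff_nonneg hb k
    have h1 := oddsPoly_coeff_nonneg hb (k + 1)
    have h2 := mul_le_mul_of_nonneg_left ih hB0
    have h3 := mul_le_mul_of_nonneg_right hμ h0
    have h4 := mul_le_mul_of_nonneg_right hk h1
    have h5 : oddsMean b s * (oddsPoly b s).coeff k
        ≤ oddsMean b s * (2 * (oddsPoly b s).coeff (k + 1)) := by linarith
    exact le_of_mul_le_mul_left h5 hμ0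

lemma oddsPoly_coeff_pos (hb : ∀ i ∈ s, 0 ≤ b i) {B : ℝ} (hB : ∑ i ∈ s, b i ^ 2 ≤ B)
    (hμ : 8 * B ≤ oddsMean b s) (hμ0 : 0 < oddsMean b s) (k : ℕ)
    (hk : (k : ℝ) ≤ 3 / 2 * oddsMean b s) : 0 < (oddsPoly b s).coeff k := by
  induction k with
  | zero => simp [oddsPoly_coeff_zero]
  | succ k ih =>
    have h := X_mul_oddsPoly_coeff_le hb hB hμ hμ0 _ hk
    push_cast at hk
    have ih := ih (by linarith)
    rw [coeff_X_mul] at h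
    linarith

lemma le_succ_mul_oddsPoly_coeff_succ' (hb : ∀ i ∈ s, 0 ≤ b i) {B : ℝ}
    (hB : ∑ i ∈ s, b i ^ 2 ≤ B) (hμ : 8 * B ≤ oddsMean b s) (hμ0 : 0 < oddsMean b s) (k : ℕ)
    (hk : (k : ℝ) ≤ 3 / 2 * oddsMean b s) :
    (oddsMean b s - 2 * B) * (oddsPoly b s).coeff k
      ≤ ((k : ℝ) + 1) * (oddsPoly b s).coeff (k + 1) := by
  have hB0 : 0 ≤ B := (Finset.sum_nonneg fun i _ => sq_nonneg (b i)).trans hB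
  have h := le_succ_mul_oddsPoly_coeff_succ hb hB k
  have h2 := mul_le_mul_of_nonneg_left (X_mul_oddsPoly_coeff_le hb hB hμ hμ0 k hk) hB0
  linarith

lemma oddsMean_erase {i : ℕ} (hi : i ∈ s) :
    oddsMean b (s.erase i) = oddsMean b s - b i / (1 + b i) := by
  unfold oddsMean
  rw [← Finset.add_sum_erase s _ hi]
  ring

/-- Near the mean, removing one factor leaves consecutive coefficients almost equal. -/
lemma abs_oddsPoly_coeff_erase_sub_le (hb : ∀ i ∈ s, 0 ≤ b i) {B : ℝ}
    (hB : ∑ i ∈ s, b i ^ 2 ≤ B) (hμ : 8 * B + 2 ≤ oddsMean b s) (k : ℕ)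
    (hk : |(k : ℝ) + 1 - oddsMean b s| ≤ 2 * B) {i : ℕ} (hi : i ∈ s) :
    |(oddsPoly b (s.erase i)).coeff k - (X * oddsPoly b (s.erase i)).coeff k|
      ≤ (16 * B + 4) / oddsMean b s * (oddsPoly b s).coeff k := by
  have hB0 : 0 ≤ B := (Finset.sum_nonneg fun i _ => sq_nonneg (b i)).trans hB
  have hμ0 : 0 < oddsMean b s := by linarith
  rw [abs_le] at hk
  obtain ⟨hk1, hk2⟩ := hk
  cases k with
  | zero => norm_num at hk1; linarith
  | succ j =>
    push_cast at hk1 hk2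
    have hb' : ∀ j ∈ s.erase i, 0 ≤ b j := fun j hj => hb j (Finset.mem_of_mem_erase hj)
    have hB' : ∑ j ∈ s.erase i, b j ^ 2 ≤ B :=
      (Finset.sum_le_sum_of_subset_of_nonneg (Finset.erase_subset i s)
        fun j _ _ => sq_nonneg (b j)).trans hB
    have hbi := hb i hi
    have hp0 : 0 ≤ b i / (1 + b i) := by positivity
    have hp1 : b i / (1 + b i) ≤ 1 := by rw [div_le_one (by positivity)]; linarith
    have hm := oddsMean_erase (b := b) hi
    have hlow := le_succ_mul_oddsPoly_coeff_succ' hb' hB' (by linarith) (by linarith) j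
      (by linarith)
    have hup := succ_mul_oddsPoly_coeff_succ_le hb' hB' j
    have hX := X_mul_oddsPoly_coeff_le hb hB (by linarith) hμ0 (j + 1) (by push_cast; linarith)
    have he := oddsPoly_coeff_erase_le hb hi j
    have h0 := oddsPoly_coeff_nonneg hb' j
    rw [coeff_X_mul] at hX ⊢
    set x := (oddsPoly b (s.erase i)).coeff j
    set y := (oddsPoly b (s.erase i)).coeff (j + 1)
    set z := (oddsPoly b s).coeff (j + 1)
    set μ := oddsMean b s
    have hz : 0 ≤ z := by linarith
    have hxz : x ≤ 2 * z := by linarith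
    have hj : μ / 2 ≤ (j : ℝ) + 1 := by linarith
    have h1 : ((j : ℝ) + 1) * (y - x) ≤ (4 * B + 1) * x := by
      have : (oddsMean b (s.erase i) + B - (j + 1)) * x ≤ (4 * B + 1) * x :=
        mul_le_mul_of_nonneg_right (by linarith) h0
      linarith
    have h2 : ((j : ℝ) + 1) * (x - y) ≤ (4 * B + 1) * x := by
      have : ((j + 1) - (oddsMean b (s.erase i) - 2 * B)) * x ≤ (4 * B + 1) * x :=
        mul_le_mul_of_nonneg_right (by linarith) h0
      linarith
    have h3 : ((j : ℝ) + 1) * |y - x| ≤ (4 * B + 1) * x := by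
      rcases abs_cases (y - x) with ⟨h, _⟩ | ⟨h, _⟩ <;> rw [h] <;> linarith
    have h4 := mul_le_mul_of_nonneg_right hj (abs_nonneg (y - x))
    have h5 := mul_le_mul_of_nonneg_left hxz (by linarith : 0 ≤ 4 * B + 1)
    rw [div_mul_eq_mul_div, le_div_iff₀ hμ0]
    linarith

lemma abs_succ_mul_oddsPoly_coeff_succ_sub_le (hb : ∀ i ∈ s, 0 ≤ b i) {B : ℝ}
    (hB : ∑ i ∈ s, b i ^ 2 ≤ B) (hμ : 8 * B + 2 ≤ oddsMean b s) (k : ℕ)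
    (hk : |(k : ℝ) + 1 - oddsMean b s| ≤ 2 * B) :
    |((k : ℝ) + 1) * (oddsPoly b s).coeff (k + 1) - oddsMean b s * (oddsPoly b s).coeff k|
      ≤ B * (16 * B + 4) / oddsMean b s * (oddsPoly b s).coeff k := by
  have hB0 : 0 ≤ B := (Finset.sum_nonneg fun i _ => sq_nonneg (b i)).trans hB
  have hμ0 : 0 < oddsMean b s := by linarith
  have hz := oddsPoly_coeff_nonneg hb k
  rw [succ_mul_oddsPoly_coeff_succ_eq hb]
  refine (Finset.abs_sum_le_sum_abs _ _).trans ?_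
  have h := sum_sq_div_one_add_mul_le hb hB (by positivity)
    fun i hi => abs_oddsPoly_coeff_erase_sub_le hb hB hμ k hk hi
  calc _ = _ := Finset.sum_congr rfl fun i hi => by
          rw [abs_mul, abs_of_nonneg (sq_div_one_add_nonneg hb i hi)]
    _ ≤ _ := h
    _ = _ := by ring

/-- The coefficients of `∏ (1 + bᵢ X)` increase strictly up to the mean, with an error inversely
proportional to the mean. -/
lemma oddsPoly_coeff_lt_succ (hb : ∀ i ∈ s, 0 ≤ b i) {B : ℝ}
    (hB : ∑ i ∈ s, b i ^ 2 ≤ B) (hμ : 8 * B + 2 ≤ oddsMean b s) (k : ℕ)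
    (hk : (k : ℝ) + 1 < oddsMean b s - B * (16 * B + 4) / oddsMean b s) :
    (oddsPoly b s).coeff k < (oddsPoly b s).coeff (k + 1) := by
  have hB0 : 0 ≤ B := (Finset.sum_nonneg fun i _ => sq_nonneg (b i)).trans hB
  have hμ0 : 0 < oddsMean b s := by linarith
  have hK : 0 ≤ B * (16 * B + 4) / oddsMean b s := by positivity
  have hz := oddsPoly_coeff_pos hb hB (by linarith) hμ0 k (by linarith)
  refine lt_of_mul_lt_mul_left (a := (k : ℝ) + 1) ?_ (by positivity)
  by_cases h : |(k : ℝ) + 1 - oddsMean b s| ≤ 2 * B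
  · have h1 := (abs_le.1 (abs_succ_mul_oddsPoly_coeff_succ_sub_le hb hB hμ k h)).1
    have h2 := mul_lt_mul_of_pos_right hk hz
    linarith
  · rw [abs_of_nonpos (by linarith)] at h
    have h1 := le_succ_mul_oddsPoly_coeff_succ' hb hB (by linarith) hμ0 k (by linarith)
    have h2 := mul_lt_mul_of_pos_right (show (k : ℝ) + 1 < oddsMean b s - 2 * B by linarith) hz
    linarith

/-- The coefficients of `∏ (1 + bᵢ X)` decrease from the mean on, with an error inversely
proportional to the mean. -/
lemma oddsPoly_coeff_succ_le (hb : ∀ i ∈ s, 0 ≤ b i) {B : ℝ}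
    (hB : ∑ i ∈ s, b i ^ 2 ≤ B) (hμ : 8 * B + 2 ≤ oddsMean b s) (k : ℕ)
    (hk : oddsMean b s + B * (16 * B + 4) / oddsMean b s < (k : ℝ) + 1) :
    (oddsPoly b s).coeff (k + 1) ≤ (oddsPoly b s).coeff k := by
  have hB0 : 0 ≤ B := (Finset.sum_nonneg fun i _ => sq_nonneg (b i)).trans hB
  have hμ0 : 0 < oddsMean b s := by linarith
  have hK : 0 ≤ B * (16 * B + 4) / oddsMean b s := by positivity
  have hz := oddsPoly_coeff_nonneg hb k
  refine le_of_mul_le_mul_left (a := (k : ℝ) + 1) ?_ (by positivity)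
  by_cases h : |(k : ℝ) + 1 - oddsMean b s| ≤ 2 * B
  · have h1 := (abs_le.1 (abs_succ_mul_oddsPoly_coeff_succ_sub_le hb hB hμ k h)).2
    have h2 := mul_le_mul_of_nonneg_right hk.le hz
    linarith
  · rw [abs_of_nonneg (by linarith)] at h
    have h1 := succ_mul_oddsPoly_coeff_succ_le hb hB k
    have h2 := mul_le_mul_of_nonneg_right (show oddsMean b s + B ≤ (k : ℝ) + 1 by linarith) hz
    linarith

end OddsPoly

lemma Real.differentiableAt_log_Gamma {x : ℝ} (hx : 0 < x) :
    DifferentiableAt ℝ (fun x => Real.log (Real.Gamma x)) x :=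
  (Real.differentiableAt_Gamma fun m => by
    have : (0 : ℝ) ≤ m := m.cast_nonneg
    linarith).log (Real.Gamma_pos_of_pos hx).ne'

lemma Real.log_Gamma_add_one {x : ℝ} (hx : 0 < x) :
    Real.log (Real.Gamma (x + 1)) = Real.log x + Real.log (Real.Gamma x) := by
  rw [Real.Gamma_add_one hx.ne', Real.log_mul hx.ne' (Real.Gamma_pos_of_pos hx).ne']

lemma digamma_add_one {x : ℝ} (hx : 0 < x) : digamma (x + 1) = digamma x + x⁻¹ := by
  unfold digamma
  rw [← deriv_comp_add_const]
  have h : (fun x => Real.log (Real.Gamma (x + 1)))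
      =ᶠ[nhds x] fun x => Real.log x + Real.log (Real.Gamma x) := by
    filter_upwards [lt_mem_nhds hx] with y hy using Real.log_Gamma_add_one hy
  rw [h.deriv_eq, deriv_fun_add (Real.differentiableAt_log hx.ne')
    (Real.differentiableAt_log_Gamma hx), Real.deriv_log, add_comm]

lemma digamma_le_log {x : ℝ} (hx : 0 < x) : digamma x ≤ Real.log x := by
  have h := Real.convexOn_log_Gamma.deriv_le_slope (x := x) (y := x + 1) hx
    (by simp only [Set.mem_Ioi]; linarith) (by linarith) (Real.differentiableAt_log_Gamma hx)
  rw [slope_def_field, Function.comp_apply, Function.comp_apply, Real.log_Gamma_add_one hx] at h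
  rw [digamma]
  simpa [Function.comp_def] using h

lemma log_le_digamma_add_one {x : ℝ} (hx : 0 < x) : Real.log x ≤ digamma (x + 1) := by
  have h := Real.convexOn_log_Gamma.slope_le_deriv (x := x) (y := x + 1) hx
    (by simp only [Set.mem_Ioi]; linarith) (by linarith)
    (Real.differentiableAt_log_Gamma (by linarith))
  rw [slope_def_field, Function.comp_apply, Function.comp_apply, Real.log_Gamma_add_one hx] at h
  rw [digamma]
  simpa [Function.comp_def] using h

lemma abs_digamma_add_natCast_sub_log_le {θ : ℝ} (hθ : 0 < θ) {n : ℕ} (hn : 1 ≤ n) :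
    |digamma (θ + n) - Real.log n| ≤ (θ + 1) / n := by
  have hn0 : (0 : ℝ) < n := by exact_mod_cast hn
  have hx : 0 < θ + n := by positivity
  have h1 := digamma_le_log hx
  have h2 := log_le_digamma_add_one hx
  rw [digamma_add_one hx] at h2
  have h3 : Real.log (θ + n) - Real.log n ≤ θ / n := by
    rw [← Real.log_div hx.ne' hn0.ne']
    have := Real.log_le_sub_one_of_pos (div_pos hx hn0)
    rw [add_div, div_self hn0.ne'] at this ⊢
    linarith
  have h4 : Real.log n ≤ Real.log (θ + n) := Real.log_le_log hn0 (by linarith)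
  have h5 : (θ + n)⁻¹ ≤ 1 / n := by
    rw [← one_div]
    exact one_div_le_one_div_of_le hn0 (by linarith)
  have h6 : 0 < θ / n := by positivity
  have h7 : (0 : ℝ) < 1 / n := by positivity
  rw [add_div, abs_le]
  constructor <;> linarith

lemma oddsMean_div_eq {θ : ℝ} (hθ : 0 < θ) (m : ℕ) :
    oddsMean (fun i => θ / i) (Finset.Icc 1 m)
      = θ * (digamma (θ + (m + 1 : ℕ)) - digamma θ) - 1 := by
  induction m with
  | zero =>
    simp only [zero_add, Nat.cast_one]
    rw [digamma_add_one hθ]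
    simp [oddsMean, hθ.ne']
  | succ m ih =>
    have hx : 0 < θ + (m + 1 : ℕ) := by positivity
    unfold oddsMean at ih ⊢
    rw [Finset.sum_Icc_succ_top (by lia), ih, Nat.cast_succ (m + 1), ← add_assoc,
      digamma_add_one hx]
    push_cast at hx ⊢
    field_simp
    ring

lemma ascPochhammer_comp_C_mul_X (θ : ℝ) (m : ℕ) :
    (ascPochhammer ℝ (m + 1)).comp (Polynomial.C θ * Polynomial.X)
      = Polynomial.C (θ * m.factorial)
        * (Polynomial.X * oddsPoly (fun i => θ / i) (Finset.Icc 1 m)) := by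
  induction m with
  | zero => simp [oddsPoly]
  | succ m ih =>
    have h : Polynomial.C θ * Polynomial.X + ((m + 1 : ℕ) : Polynomial ℝ)
        = Polynomial.C ((m + 1 : ℕ) : ℝ)
          * (1 + Polynomial.C (θ / (m + 1 : ℕ)) * Polynomial.X) := by
      rw [mul_add, ← mul_assoc, ← Polynomial.C_mul, mul_div_cancel₀ _ (by positivity),
        Polynomial.C_eq_natCast]
      ring
    rw [ascPochhammer_succ_right, Polynomial.mul_comp, ih, Polynomial.add_comp, Polynomial.X_comp,
      Polynomial.natCast_comp, h, Nat.factorial_succ]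
    unfold oddsPoly
    rw [Finset.prod_Icc_succ_top (by lia)]
    simp only [Polynomial.C_mul, Nat.cast_mul]
    ring

lemma ewensPMF_succ (θ : ℝ) (m k : ℕ) :
    ewensPMF (m + 1) θ (k + 1) = θ * m.factorial / (ascPochhammer ℝ (m + 1)).eval θ
      * (oddsPoly (fun i => θ / i) (Finset.Icc 1 m)).coeff k := by
  have h := congrArg (fun p => Polynomial.coeff p (k + 1)) (ascPochhammer_comp_C_mul_X θ m)
  simp only [Polynomial.comp_C_mul_X_coeff, Polynomial.coeff_C_mul, Polynomial.coeff_X_mul] at h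
  rw [ewensPMF, ← eq_natCast (Nat.castRingHom ℝ), ← Polynomial.coeff_map, ascPochhammer_map,
    mul_comm (θ ^ _), h]
  ring

lemma oddsPoly_div_coeff_eq_zero {θ : ℝ} {m k : ℕ} (hk : m < k) :
    (oddsPoly (fun i => θ / i) (Finset.Icc 1 m)).coeff k = 0 := by
  refine Polynomial.coeff_eq_zero_of_natDegree_lt (lt_of_le_of_lt ?_ hk)
  refine (Polynomial.natDegree_prod_le _ _).trans ?_
  calc _ ≤ ∑ i ∈ Finset.Icc 1 m, 1 := Finset.sum_le_sum fun i _ => by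
          rw [add_comm, ← Polynomial.C_1]
          exact Polynomial.natDegree_linear_le
    _ = m := by simp

/-- If the coefficients of `∏ (1 + θ/i X)` increase strictly up to `k₀` and decrease afterwards,
then the least mode is `k₀ + 1`. -/
lemma IsLeastMode.eq_succ {θ : ℝ} (hθ : 0 < θ) {m k₀ u : ℕ} (hu : IsLeastMode θ (m + 1) u)
    (hlt : ∀ k < k₀, (oddsPoly (fun i => θ / i) (Finset.Icc 1 m)).coeff k
      < (oddsPoly (fun i => θ / i) (Finset.Icc 1 m)).coeff (k + 1))
    (hle : ∀ k ≥ k₀, (oddsPoly (fun i => θ / i) (Finset.Icc 1 m)).coeff (k + 1)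
      ≤ (oddsPoly (fun i => θ / i) (Finset.Icc 1 m)).coeff k) :
    u = k₀ + 1 := by
  set e := (oddsPoly (fun i => θ / i) (Finset.Icc 1 m)).coeff with he
  have hc : 0 < θ * m.factorial / (ascPochhammer ℝ (m + 1)).eval θ := by
    have := ascPochhammer_pos (m + 1) θ hθ
    positivity
  have hlt' : ∀ k < k₀, e k < e k₀ := fun k hk =>
    strictMonoOn_Iic_of_lt_succ (n := k₀) (fun j hj => hlt j hj) (Set.mem_Iic.2 hk.le)
      (Set.mem_Iic.2 le_rfl) hk
  have hle' : ∀ k, e k ≤ e k₀ := fun k => by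
    rcases lt_or_ge k k₀ with hk | hk
    · exact (hlt' k hk).le
    · exact antitoneOn_nat_Ici_of_succ_le hle (Set.mem_Ici.2 le_rfl) hk hk
  have hk₀ : k₀ ≤ m := by
    by_contra! h
    have h0 := hle' 0
    rw [he, oddsPoly_div_coeff_eq_zero h, oddsPoly_coeff_zero] at h0
    linarith
  obtain ⟨hmem, hmax, hleast⟩ := hu
  have hmode : k₀ + 1 ∈ Finset.Icc 1 (m + 1) := by simpa using hk₀
  refine le_antisymm (hleast _ hmode fun k hk => ?_) ?_
  · obtain ⟨j, rfl⟩ := Nat.exists_eq_add_of_le' (Finset.mem_Icc.1 hk).1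
    rw [ewensPMF_succ, ewensPMF_succ]
    exact mul_le_mul_of_nonneg_left (hle' j) hc.le
  · obtain ⟨j, rfl⟩ := Nat.exists_eq_add_of_le' (Finset.mem_Icc.1 hmem).1
    have h := hmax _ hmode
    rw [ewensPMF_succ, ewensPMF_succ] at h
    by_contra! hj
    exact absurd (le_of_mul_le_mul_left h hc) (not_le.2 (hlt' j (by lia)))

/-- A real `y` whose fractional part is far from `1/2` makes `y + 1/2` far from the integers. -/
lemma floor_add_half_bounds {y c : ℝ} (h : c < |Int.fract y - 1 / 2|) :
    (⌊y + 1 / 2⌋ : ℝ) + c < y + 1 / 2 ∧ y + 1 / 2 + c < ⌊y + 1 / 2⌋ + 1 := by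
  have h0 := Int.fract_nonneg y
  have h1 := Int.fract_lt_one y
  have hy := Int.floor_add_fract y
  rcases lt_or_ge (Int.fract y) (1 / 2) with hf | hf
  · rw [abs_of_neg (by linarith)] at h
    have : ⌊y + 1 / 2⌋ = ⌊y⌋ := Int.floor_eq_iff.2 ⟨by linarith, by linarith⟩
    rw [this]
    constructor <;> linarith
  · rw [abs_of_nonneg (by linarith)] at h
    have : ⌊y + 1 / 2⌋ = ⌊y⌋ + 1 :=
      Int.floor_eq_iff.2 ⟨by push_cast; linarith, by push_cast; linarith⟩
    rw [this]
    push_cast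
    constructor <;> linarith

/-- If the fractional part of `u_n*(θ)` stays away from `1/2` by at least `C₀/log n`,
then the mode is the nearest integer to `u_n*(θ)`. -/
theorem ewens_mode_nearest_integer (θ : ℝ) (hθ : 0 < θ) (u : ℕ → ℕ)
    (hu : ∀ n ≥ 1, IsLeastMode θ n (u n)) :
    ∃ C₀ > (0 : ℝ), ∃ N : ℕ, ∀ n ≥ N,
      |Int.fract (uStar n θ) - 1 / 2| > C₀ / Real.log n →
        (u n : ℤ) = ⌊uStar n θ + 1 / 2⌋ ∧
          (u n : ℤ) = ⌊θ * Real.log n - θ * digamma θ⌋ := by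
  set B : ℝ := ∑' i : ℕ, (θ / i) ^ 2
  have hsum : Summable fun i : ℕ => (θ / i) ^ 2 := by
    simp only [div_eq_mul_inv, mul_pow, inv_pow]
    exact (Real.summable_nat_pow_inv.2 one_lt_two).mul_left _
  have hB0 : 0 ≤ B := tsum_nonneg fun i => sq_nonneg _
  have hB (m : ℕ) : ∑ i ∈ Finset.Icc 1 m, (θ / i) ^ 2 ≤ B :=
    hsum.sum_le_tsum _ fun i _ => sq_nonneg _
  set K : ℝ := B * (16 * B + 4)
  have hK : 0 ≤ K := by positivity
  refine ⟨2 * K / θ + θ * (θ + 1), by positivity, ?_⟩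
  have hev := (Real.tendsto_log_atTop.comp tendsto_natCast_atTop_atTop).eventually_ge_atTop
    (max 1 (2 / θ * max (θ * (θ + 1 + digamma θ) + 1) (8 * B + 2)))
  obtain ⟨N, hN⟩ := eventually_atTop.1 hev
  refine ⟨max N 1, fun n hn hfr => ?_⟩
  obtain ⟨m, rfl⟩ := Nat.exists_eq_add_of_le' ((le_max_right N 1).trans hn)
  have hL := hN _ ((le_max_left N 1).trans hn)
  have hn1 : (0 : ℝ) < (m + 1 : ℕ) := by positivity
  have hb : ∀ i ∈ Finset.Icc 1 m, 0 ≤ θ / (i : ℝ) := fun i _ => by positivity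
  have hlogn := Real.log_le_sub_one_of_pos hn1
  have hψ := abs_digamma_add_natCast_sub_log_le hθ (Nat.le_add_left 1 m)
  have hμ := oddsMean_div_eq hθ m
  have hx : uStar (m + 1) θ + 1 / 2 = θ * Real.log (m + 1 : ℕ) - θ * digamma θ := by
    rw [uStar]; ring
  obtain ⟨hfl1, hfl2⟩ := floor_add_half_bounds hfr
  rw [← hx, and_self]
  set μ := oddsMean (fun i : ℕ => θ / (i : ℝ)) (Finset.Icc 1 m)
  simp only [Function.comp_apply] at hL
  set L := Real.log (m + 1 : ℕ)
  have hL1 : 1 ≤ L := (le_max_left _ _).trans hL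
  have hL2 := (le_max_right _ _).trans hL
  rw [div_mul_eq_mul_div, div_le_iff₀ hθ] at hL2
  have hL3 := (le_max_left (θ * (θ + 1 + digamma θ) + 1) (8 * B + 2))
  have hL4 := (le_max_right (θ * (θ + 1 + digamma θ) + 1) (8 * B + 2))
  have hψL : |θ * digamma (θ + (m + 1 : ℕ)) - θ * L| ≤ θ * (θ + 1) / L := by
    rw [← mul_sub, abs_mul, abs_of_pos hθ, mul_div_assoc]
    exact mul_le_mul_of_nonneg_left
      (hψ.trans (div_le_div_of_nonneg_left (by positivity) (by linarith) (by linarith))) hθ.le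
  have hψ1 : θ * (θ + 1) / L ≤ θ * (θ + 1) := div_le_self (by positivity) hL1
  have hψ2 := abs_le.1 hψL
  have hμL : θ / 2 * L ≤ μ := by linarith
  have hμB : 8 * B + 2 ≤ μ := by linarith
  have hKμ : K / μ ≤ 2 * K / θ / L := by
    rw [div_div, div_le_div_iff₀ (by linarith) (by positivity)]
    have := mul_le_mul_of_nonneg_left hμL hK
    linarith
  rw [add_div] at hfl1 hfl2
  have hfloor : 1 ≤ ⌊uStar (m + 1) θ + 1 / 2⌋ := by
    rw [Int.le_floor, hx]
    have := mul_pos hθ hθ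
    push_cast
    linarith
  obtain ⟨k₀, hk₀⟩ := Int.eq_ofNat_of_zero_le (sub_nonneg.2 hfloor)
  have hk₀' : ⌊uStar (m + 1) θ + 1 / 2⌋ = ((k₀ + 1 : ℕ) : ℤ) := by push_cast; linarith
  rw [hk₀'] at hfl1 hfl2 ⊢
  push_cast at hfl1 hfl2
  have hlt (k : ℕ) (hk : k < k₀) := oddsPoly_coeff_lt_succ hb (hB m) hμB k (by
    have : (k : ℝ) + 1 ≤ k₀ := by exact_mod_cast hk
    linarith)
  have hle (k : ℕ) (hk : k ≥ k₀) := oddsPoly_coeff_succ_le hb (hB m) hμB k (by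
    have : (k₀ : ℝ) ≤ k := by exact_mod_cast hk
    linarith)
  exact_mod_cast (hu (m + 1) (Nat.le_add_left 1 m)).eq_succ hθ hlt hle
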